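/- Let β ∈ (0,2) and set β* = (1+√5)/2. Let L_β be the operator generated by the power-type kernel k_β(j)=|j|^{−(1+β)} (j ≠ 0), k_β(0)=0. If β ∈ (0,β*], then there exist constants c₁, c₂, ν > 0 and a CD-function F such that L_β satisfies CD_Υ(0,F), F(x)/(c₁ x^{(1+2β)/β}) → 1 as x → 0+, and F(x)/(c₂ e^{νx}) → 1 as x → ∞. If β ∈ (β*,2), then for every ε ∈ (0, β−1) there exist constants c₃, c₄, ν > 0 and a CD-function F such that L_β satisfies CD_Υ(0,F), F(x)/(c₃ x^{(β−ε)/(β−ε−1)}) → 1 as x → 0+, and F(x)/(c₄ e^{νx}) → 1 as x → ∞. -/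

import Mathlib

open scoped BigOperators
open Filter Set

noncomputable section

/-- `Υ(r) = e^r − 1 − r`. -/
def Ups (r : ℝ) : ℝ := Real.exp r - 1 - r

/-- `H(x) = (1/2) e^{−x} Υ(2x)`. -/
def Hfun (x : ℝ) : ℝ := (1 / 2) * Real.exp (-x) * Ups (2 * x)

/-- The long-range jump operator `L u (x) = ∑_{j∈ℤ} k(j)(u(x+j) − u(x))`. -/
def Lop (k : ℤ → ℝ) (u : ℤ → ℝ) (x : ℤ) : ℝ := ∑' j : ℤ, k j * (u (x + j) - u x)

/-- `Ψ_Υ(u)(x) = ∑_{j∈ℤ} k(j) Υ(u(x+j) − u(x))`. -/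
def PsiUps (k : ℤ → ℝ) (u : ℤ → ℝ) (x : ℤ) : ℝ := ∑' j : ℤ, k j * Ups (u (x + j) - u x)

/-- `Ψ_{2,Υ}(u)(x)`. -/
def Psi2 (k : ℤ → ℝ) (u : ℤ → ℝ) (x : ℤ) : ℝ :=
  (1 / 2) * ∑' p : ℤ × ℤ, k p.1 * k p.2 * Real.exp (u (x + p.2) - u x) *
    Ups (u (x + p.1 + p.2) - u (x + p.1) - u (x + p.2) + u x)

/-- A bounded function on `ℤ`. -/
def BddFun (u : ℤ → ℝ) : Prop := ∃ M : ℝ, ∀ x : ℤ, |u x| ≤ M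

/-- A nontrivial symmetric integrable kernel on `ℤ` vanishing at `0`. -/
structure IsKernel (k : ℤ → ℝ) : Prop where
  nonneg : ∀ j, 0 ≤ k j
  zero_at_zero : k 0 = 0
  symm : ∀ j, k (-j) = k j
  summable : Summable k
  nontrivial : ∃ j, k j ≠ 0

/-- A CD-function: continuous on `[0,∞)`, nonnegative, `F(0)=0`, `r ↦ F(r)/r` strictly
increasing on `(0,∞)` and `1/F` integrable at `∞`. -/
def IsCDFunction (F : ℝ → ℝ) : Prop :=
  ContinuousOn F (Ici 0) ∧ (∀ r, 0 ≤ r → 0 ≤ F r) ∧ F 0 = 0 ∧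
    StrictMonoOn (fun r => F r / r) (Ioi 0) ∧
    ∃ a, 0 < a ∧ MeasureTheory.IntegrableOn (fun r => 1 / F r) (Ici a)

/-- The curvature-dimension condition `CD_Υ(0,F)` for the operator generated by `k`. -/
def CDUps (k : ℤ → ℝ) (F : ℝ → ℝ) : Prop :=
  ∀ u : ℤ → ℝ, BddFun u → ∀ x : ℤ, 0 ≤ -Lop k u x → F (-Lop k u x) ≤ Psi2 k u x

/-- The power-type kernel `k_β(j) = |j|^{−(1+β)}` for `j ≠ 0`, `k_β(0) = 0`. -/
def kpow (β : ℝ) (j : ℤ) : ℝ := if j = 0 then 0 else |(j : ℝ)| ^ (-(1 + β))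


lemma Hfun_ge_cosh (a : ℝ) : Real.exp a / 2 + Real.exp (-a) / 2 - 1 ≤ Hfun a := by
  unfold Hfun Ups
  have h1 : Real.exp (-a) * Real.exp (2 * a) = Real.exp a := by
    rw [← Real.exp_add]; ring_nf
  have h2 : Real.exp (-a) * Real.exp a = 1 := by
    rw [← Real.exp_add]; simp
  have h3 := Real.add_one_le_exp a
  have h4 := Real.exp_pos (-a)
  nlinarith

lemma Hfun_ge_sq (a : ℝ) : a ^ 2 / 4 ≤ Hfun a := by
  have h := Hfun_ge_cosh a
  rcases le_total 0 a with ha | ha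
  · have h1 := Real.quadratic_le_exp_of_nonneg ha
    have h2 := Real.add_one_le_exp (-a)
    linarith
  · have h1 := Real.quadratic_le_exp_of_nonneg (neg_nonneg.2 ha)
    have h2 := Real.add_one_le_exp a
    nlinarith

lemma Hfun_nonneg (a : ℝ) : 0 ≤ Hfun a := le_trans (by positivity) (Hfun_ge_sq a)

lemma exp_le_Hfun (a : ℝ) : Real.exp a ≤ 2 + 2 * Hfun a := by
  have := Hfun_ge_cosh a
  have := Real.exp_pos (-a)
  linarith

lemma Ups_nonneg (d : ℝ) : 0 ≤ Ups d := by
  have := Real.add_one_le_exp d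
  unfold Ups; linarith

lemma Ups_lower (d s : ℝ) (hs : s ≤ 1) : -s * d - s ^ 2 ≤ Ups d := by
  unfold Ups
  have h1 : Real.exp d = Real.exp (d + s) * Real.exp (-s) := by
    rw [← Real.exp_add]; ring_nf
  have h2 := Real.add_one_le_exp (d + s)
  have h3 := Real.add_one_le_exp (-s)
  have h4 : Real.exp (d + s) * (1 - s) ≤ Real.exp d := by
    rw [h1]; apply mul_le_mul_of_nonneg_left (by linarith) (Real.exp_pos _).le
  have h5 : (d + s + 1) * (1 - s) ≤ Real.exp (d + s) * (1 - s) :=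
    mul_le_mul_of_nonneg_right h2 (by linarith)
  nlinarith

lemma abs_le_Ups (d t : ℝ) (ht : 0 < t) (ht1 : t ≤ 1) : |d| ≤ t + Ups d / t := by
  have h1 := Ups_lower d t ht1
  have h2 := Ups_lower d (-t) (by linarith)
  have h3 : |d| * t ≤ t ^ 2 + Ups d := by
    rcases abs_cases d with ⟨h, _⟩ | ⟨h, _⟩ <;> rw [h] <;> nlinarith
  rw [show t + Ups d / t = (t ^ 2 + Ups d) / t by field_simp]
  rwa [le_div_iff₀ ht]

lemma head_step (b : ℝ) (hb : 0 < b) (hb1 : b ≤ 1) (x : ℝ) (hx : 0 ≤ x) :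
    b * (x + 1) ^ (b - 1) + x ^ b ≤ (x + 1) ^ b := by
  have h := rpow_one_add_le_one_add_mul_self (s := -1 / (x + 1)) (p := b) (by
    rw [le_div_iff₀ (by linarith)]; linarith) hb.le hb1
  have e : x ^ b = (x + 1) ^ b * (1 + -1 / (x + 1)) ^ b := by
    rw [← Real.mul_rpow (by linarith)]
    · congr 1; field_simp; ring
    · have : 1 + -1 / (x + 1) = x / (x + 1) := by field_simp; ring
      rw [this]; positivity
  rw [e, Real.rpow_sub_one (by linarith)]
  have hp : 0 < (x + 1) ^ b := by positivity
  have := mul_le_mul_of_nonneg_left h hp.le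
  have e2 : b * ((x + 1) ^ b / (x + 1)) + (x + 1) ^ b * (1 + b * (-1 / (x + 1))) = (x + 1) ^ b := by
    field_simp; ring
  linarith

lemma head_sum (b : ℝ) (hb : 0 < b) (hb1 : b ≤ 1) (N : ℕ) :
    ∑ i ∈ Finset.range N, ((i : ℝ) + 1) ^ (b - 1) ≤ (N : ℝ) ^ b / b := by
  induction N with
  | zero => simp [Real.zero_rpow hb.ne']
  | succ n ih =>
    rw [Finset.sum_range_succ]
    have := head_step b hb hb1 n (by positivity)
    rw [le_div_iff₀ hb] at ih ⊢
    push_cast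
    nlinarith

lemma tail_step (s : ℝ) (hs : 0 < s) (x : ℝ) (hx : 0 < x) :
    s * (x + 1) ^ (-1 - s) + (x + 1) ^ (-s) ≤ x ^ (-s) := by
  have e : x ^ (-s) = (x + 1) ^ (-s) * (x / (x + 1)) ^ (-s) := by
    rw [← Real.mul_rpow (by linarith) (by positivity)]
    congr 1; field_simp
  have h : 1 + s / (x + 1) ≤ (x / (x + 1)) ^ (-s) := by
    rw [Real.rpow_def_of_pos (by positivity)]
    have h1 := Real.add_one_le_exp (Real.log (x / (x + 1)) * -s)
    have h2 := Real.log_le_sub_one_of_pos (show 0 < x / (x + 1) by positivity)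
    have h3 : x / (x + 1) - 1 = -(1 / (x + 1)) := by field_simp; ring
    have h4 : s / (x + 1) = s * (1 / (x + 1)) := by ring
    rw [h4]
    nlinarith
  have hp : 0 < (x + 1) ^ (-s) := by positivity
  have := mul_le_mul_of_nonneg_left h hp.le
  rw [e, show -1 - s = -s - 1 by ring, Real.rpow_sub_one (by linarith)]
  have e2 : s * ((x + 1) ^ (-s) / (x + 1)) + (x + 1) ^ (-s) = (x + 1) ^ (-s) * (1 + s / (x + 1)) := by
    field_simp; ring
  linarith

lemma tail_sum (s : ℝ) (hs : 0 < s) (N : ℕ) (hN : 1 ≤ N) (M : ℕ) :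
    ∑ i ∈ Finset.range M, (((N + 1 + i : ℕ)) : ℝ) ^ (-1 - s) ≤ (N : ℝ) ^ (-s) / s := by
  have hN' : (1 : ℝ) ≤ N := by exact_mod_cast hN
  have key : ∑ i ∈ Finset.range M, (((N + 1 + i : ℕ)) : ℝ) ^ (-1 - s)
      ≤ ((N : ℝ) ^ (-s) - ((N : ℝ) + M) ^ (-s)) / s := by
    induction M with
    | zero => simp
    | succ n ih =>
      rw [Finset.sum_range_succ]
      have := tail_step s hs ((N : ℝ) + n) (by positivity)
      rw [le_div_iff₀ hs] at ih ⊢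
      push_cast at ih ⊢
      rw [show (N : ℝ) + 1 + n = N + n + 1 by ring, show (N : ℝ) + (n + 1) = N + n + 1 by ring]
      nlinarith
  refine key.trans ?_
  gcongr
  have : 0 ≤ ((N : ℝ) + M) ^ (-s) := by positivity
  linarith

/-- the kernel at naturals -/
lemma kpow_nat (β : ℝ) (n : ℕ) (hn : 1 ≤ n) : kpow β n = (n : ℝ) ^ (-1 - β) := by
  unfold kpow
  rw [if_neg (by exact_mod_cast (by omega : n ≠ 0))]
  simp only [Int.cast_natCast, Nat.abs_cast]
  congr 1; ring

lemma kpow_zero (β : ℝ) : kpow β 0 = 0 := by simp [kpow]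

lemma kpow_neg (β : ℝ) (j : ℤ) : kpow β (-j) = kpow β j := by simp [kpow]

lemma kpow_nonneg (β : ℝ) (j : ℤ) : 0 ≤ kpow β j := by
  unfold kpow; split_ifs <;> positivity

lemma kpow_one (β : ℝ) : kpow β 1 = 1 := by simp [kpow]

lemma kpow_summable (β : ℝ) (hβ : 0 < β) : Summable (kpow β) := by
  have hn : Summable (fun n : ℕ => kpow β n) := by
    have := (Real.summable_nat_rpow (p := -1 - β)).2 (by linarith)
    refine Summable.of_nonneg_of_le (fun n => kpow_nonneg β n) (fun n => ?_) this
    rcases Nat.eq_zero_or_pos n with rfl | h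
    · simp [kpow_zero]; positivity
    · rw [kpow_nat β n h]
  exact Summable.of_nat_of_neg hn (by simpa [kpow_neg] using hn)

/-- pointwise tail bound -/
lemma point_tail (κ a μ : ℝ) (hκ : 0 < κ) (hμ : 0 < μ) :
    κ * a ≤ κ * (-Real.log (μ * κ)) + μ * κ ^ 2 * (2 + 2 * Hfun a) := by
  have h1 := Real.add_one_le_exp (a + Real.log (μ * κ))
  rw [Real.exp_add, Real.exp_log (by positivity)] at h1
  have h2 := exp_le_Hfun a
  have h3 : a ≤ -Real.log (μ * κ) + (2 + 2 * Hfun a) * (μ * κ) := by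
    have : Real.exp a * (μ * κ) ≤ (2 + 2 * Hfun a) * (μ * κ) :=
      mul_le_mul_of_nonneg_right h2 (by positivity)
    linarith
  nlinarith [mul_le_mul_of_nonneg_left h3 hκ.le]

lemma point_head (κ a τ : ℝ) (hκ : 0 < κ) (hτ : 0 < τ) :
    κ * a ≤ κ * τ + κ / τ * Hfun a := by
  have h := Hfun_ge_sq a
  have : a ≤ τ + Hfun a / τ := by
    rw [show τ + Hfun a / τ = (τ ^ 2 + Hfun a) / τ by field_simp, le_div_iff₀ hτ]
    nlinarith [sq_nonneg (a - 2 * τ), sq_nonneg τ]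
  calc κ * a ≤ κ * (τ + Hfun a / τ) := mul_le_mul_of_nonneg_left this hκ.le
    _ = _ := by ring

lemma sum_shift_le (f : ℕ → ℝ) (hf : ∀ n, 0 ≤ f n) (P : ℝ)
    (h : ∀ M, ∑ n ∈ Finset.range M, f n ≤ P) (N M : ℕ) :
    ∑ i ∈ Finset.range M, f (N + i) ≤ P := by
  have := h (N + M)
  rw [Finset.sum_range_add] at this
  have h0 : 0 ≤ ∑ n ∈ Finset.range N, f n := Finset.sum_nonneg fun _ _ => hf _
  linarith

lemma kpow_pos (β : ℝ) (n : ℕ) (hn : 1 ≤ n) : 0 < kpow β n := by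
  rw [kpow_nat β n hn]
  have : (0 : ℝ) < n := by exact_mod_cast hn
  positivity

lemma tail_gen (β : ℝ) (hβ : 0 < β) (a : ℕ → ℝ) (P : ℝ)
    (hP : ∀ M, ∑ n ∈ Finset.range M, (kpow β n) ^ 2 * Hfun (a n) ≤ P)
    (N : ℕ) (hN : 1 ≤ N) (μ D s : ℝ) (hμ : 0 < μ) (hs : 0 < s)
    (hD0 : 0 ≤ D)
    (hD : ∀ n : ℕ, N + 1 ≤ n → kpow β n * (-Real.log (μ * kpow β n)) ≤ D * (n : ℝ) ^ (-1 - s))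
    (hμ1 : ∀ n : ℕ, N + 1 ≤ n → μ * kpow β n ≤ 1) (M : ℕ) :
    ∑ i ∈ Finset.range M, kpow β ((N + 1 + i : ℕ)) * a (N + 1 + i) ≤
      D * ((N : ℝ) ^ (-s) / s) + 2 * ((N : ℝ) ^ (-β) / β) + 2 * μ * P := by
  have h1 : ∀ i ∈ Finset.range M, kpow β ((N + 1 + i : ℕ)) * a (N + 1 + i) ≤
      D * ((N + 1 + i : ℕ) : ℝ) ^ (-1 - s) + 2 * ((N + 1 + i : ℕ) : ℝ) ^ (-1 - β)
      + 2 * μ * ((kpow β ((N + 1 + i : ℕ))) ^ 2 * Hfun (a (N + 1 + i))) := by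
    intro i _
    have hk := kpow_pos β (N + 1 + i) (by omega)
    have h2 := point_tail _ (a (N + 1 + i)) μ hk hμ
    have h3 := hD (N + 1 + i) (by omega)
    have h4 := mul_le_mul_of_nonneg_right (hμ1 (N + 1 + i) (by omega)) hk.le
    rw [← kpow_nat β (N + 1 + i) (by omega)]
    nlinarith
  refine (Finset.sum_le_sum h1).trans ?_
  rw [Finset.sum_add_distrib, Finset.sum_add_distrib, ← Finset.mul_sum, ← Finset.mul_sum,
    ← Finset.mul_sum]
  have t1 := mul_le_mul_of_nonneg_left (tail_sum s hs N hN M) hD0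
  have t2 := tail_sum β hβ N hN M
  have t3 := mul_le_mul_of_nonneg_left (sum_shift_le (fun n => (kpow β n) ^ 2 * Hfun (a n))
    (fun n => mul_nonneg (sq_nonneg _) (Hfun_nonneg _)) P hP (N + 1) M) (show 0 ≤ 2 * μ by positivity)
  linarith

lemma log_kpow (β : ℝ) (n : ℕ) (hn : 1 ≤ n) : Real.log (kpow β n) = -(1 + β) * Real.log n := by
  have : (0 : ℝ) < n := by exact_mod_cast hn
  rw [kpow_nat β n hn, Real.log_rpow this]; ring

lemma log_le' (x θ : ℝ) (hx : 0 ≤ x) (hθ : 0 < θ) : Real.log x ≤ x ^ θ / θ :=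
  Real.log_le_rpow_div hx hθ

lemma large_aux (A B E l x y : ℝ) (hl : 0 ≤ l) (hA : 0 ≤ A) (hB : 0 ≤ B) (hE : 0 ≤ E)
    (hx : x ≤ l + 4) (hy : y ≤ A * l + B + E + 2) : x + y ≤ (1 + A + B + E + 6) * (1 + l) := by
  nlinarith [mul_nonneg hB hl, mul_nonneg hE hl, mul_nonneg hA hl]

/-- large regime -/
lemma large_bound (β : ℝ) (hβ : 0 < β) : ∃ C : ℝ, 0 < C ∧ ∀ (a : ℕ → ℝ) (P : ℝ), 1 ≤ P →
    (∀ M, ∑ n ∈ Finset.range M, (kpow β n) ^ 2 * Hfun (a n) ≤ P) →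
    ∀ M, ∑ n ∈ Finset.range (2 + M), kpow β n * a n ≤ C * (1 + Real.log P) := by
  refine ⟨1 + 2 / β + (1 + β) * (2 / β) * (2 / β) + 2 * (1 / β) + 6, by positivity, ?_⟩
  intro a P hP h M
  have hP0 : 0 < P := by linarith
  have hl : 0 ≤ Real.log P := Real.log_nonneg hP
  rw [Finset.sum_range_add]
  have t := tail_gen β hβ a P h 1 le_rfl P⁻¹ (Real.log P + (1 + β) * (2 / β)) (β / 2)
    (by positivity) (by positivity) (by positivity) ?_ ?_ M
  · have hH := h 2
    have hp := point_tail 1 (a 1) P⁻¹ one_pos (by positivity)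
    simp only [Finset.sum_range_succ, Finset.sum_range_zero, Nat.cast_zero, Nat.cast_one,
      kpow_zero, kpow_one] at hH ⊢
    have e : P⁻¹ * P = 1 := by field_simp
    have e1 : P⁻¹ ≤ 1 := inv_le_one_of_one_le₀ hP
    have hH' : P⁻¹ * Hfun (a 1) ≤ 1 := by
      rw [← e]; apply mul_le_mul_of_nonneg_left _ (by positivity); linarith
    simp only [mul_one, Real.log_inv, neg_neg, one_mul, one_pow] at hp
    norm_num at t ⊢
    have e3 : 2 * P⁻¹ * P = 2 := by field_simp
    have e4 : (Real.log P + (1 + β) * (2 / β)) * (2 / β) = 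
      (2/β) * Real.log P + (1 + β) * (2 / β) * (2 / β) := by ring
    have e2 : a 1 ≤ Real.log P + 4 := by nlinarith
    rw [e3] at t
    have : ∑ x ∈ Finset.range M, kpow β (2 + (x:ℤ)) * a (2 + x) ≤ 
      (2/β) * Real.log P + (1 + β) * (2 / β) * (2 / β) + 2 * (1 / β) + 2 := by
      refine t.trans (le_of_eq ?_)
      rw [e4]; ring
    have e5 : β⁻¹ = 1 / β := by ring
    rw [e5]
    exact large_aux _ _ _ _ _ _ hl (by positivity) (by positivity) (by positivity) e2 this
  · intro n hn
    have hn0 : (1 : ℝ) ≤ n := by exact_mod_cast (by omega : 1 ≤ n)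
    have hn1 : (0 : ℝ) < n := by linarith
    have hk := kpow_pos β n (by omega)
    rw [Real.log_mul (by positivity) hk.ne', Real.log_inv, log_kpow β n (by omega),
      kpow_nat β n (by omega)]
    have l := log_le' n (β / 2) hn1.le (by positivity)
    have e : (n : ℝ) ^ (-1 - β / 2) = (n : ℝ) ^ (-1 - β) * (n : ℝ) ^ (β / 2) := by
      rw [← Real.rpow_add hn1]; ring_nf
    have e1 : 1 ≤ (n : ℝ) ^ (β / 2) := Real.one_le_rpow hn0 (by positivity)
    rw [e]
    have hk' : 0 < (n : ℝ) ^ (-1 - β) := by positivity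
    rw [mul_left_comm]
    apply mul_le_mul_of_nonneg_left _ hk'.le
    have : (1 + β) * Real.log n ≤ (1 + β) * ((n : ℝ) ^ (β / 2) / (β / 2)) :=
      mul_le_mul_of_nonneg_left l (by linarith)
    have e3 : (1 + β) * ((n : ℝ) ^ (β / 2) / (β / 2)) = (1 + β) * (2 / β) * (n : ℝ) ^ (β / 2) := by
      field_simp
    nlinarith
  · intro n hn
    have hn0 : (1 : ℝ) ≤ n := by exact_mod_cast (by omega : 1 ≤ n)
    rw [kpow_nat β n (by omega)]
    have e1 : P⁻¹ ≤ 1 := inv_le_one_of_one_le₀ hP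
    have e2 : (n : ℝ) ^ (-1 - β) ≤ 1 := Real.rpow_le_one_of_one_le_of_nonpos hn0 (by linarith)
    exact mul_le_one₀ e1 (by positivity) e2

/-- small regime, first exponent -/
lemma small_bound_one (β : ℝ) (hβ : 0 < β) : ∃ C : ℝ, 0 < C ∧ ∀ (a : ℕ → ℝ) (P : ℝ) (N : ℕ), 1 ≤ N →
    P ≤ (N : ℝ) ^ (-(1 + 2 * β)) →
    (∀ M, ∑ n ∈ Finset.range M, (kpow β n) ^ 2 * Hfun (a n) ≤ P) →
    ∀ M, ∑ n ∈ Finset.range (N + 1 + M), kpow β n * a n ≤ C * (N : ℝ) ^ (-β) := by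
  refine ⟨2 + ((1 + β) * (2 / β) * (2 / β) + 2 / β + 2), by positivity, ?_⟩
  intro a P N hN hPN h M
  have hN1 : (1 : ℝ) ≤ N := by exact_mod_cast hN
  have hN0 : (0 : ℝ) < N := by linarith
  rw [Finset.sum_range_add]
  have eP : (N : ℝ) ^ (1 + β) * P ≤ (N : ℝ) ^ (-β) := by
    calc _ ≤ (N : ℝ) ^ (1 + β) * (N : ℝ) ^ (-(1 + 2 * β)) :=
          mul_le_mul_of_nonneg_left hPN (by positivity)
      _ = _ := by rw [← Real.rpow_add hN0]; ring_nf
  have head : ∑ n ∈ Finset.range (N + 1), kpow β n * a n ≤ 2 * (N : ℝ) ^ (-β) := by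
    have hb : ∀ n ∈ Finset.range (N + 1), kpow β n * a n ≤
        (if n = 0 then 0 else (N : ℝ) ^ (-1 - β)) +
          (N : ℝ) ^ (1 + β) * ((kpow β n) ^ 2 * Hfun (a n)) := by
      intro n hn
      rcases Nat.eq_zero_or_pos n with rfl | hn0
      · simp [kpow_zero]
      · rw [if_neg (by omega)]
        have hk := kpow_pos β n hn0
        have := point_head (kpow β n) (a n) ((N : ℝ) ^ (-1 - β) / kpow β n) hk (by positivity)
        refine this.trans (le_of_eq ?_)
        have e : (N : ℝ) ^ (1 + β) * (N : ℝ) ^ (-1 - β) = 1 := by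
          rw [← Real.rpow_add hN0]; ring_nf; simp
        have e2 : (N : ℝ) ^ (1 + β) = 1 / (N : ℝ) ^ (-1 - β) := by
          rw [eq_div_iff (by positivity)]; exact e
        rw [e2]
        field_simp
    refine (Finset.sum_le_sum hb).trans ?_
    rw [Finset.sum_add_distrib, ← Finset.mul_sum]
    have s1 : ∑ n ∈ Finset.range (N + 1), (if n = 0 then 0 else (N : ℝ) ^ (-1 - β)) = (N : ℝ) ^ (-β) := by
      rw [Finset.sum_range_succ']
      simp
      rw [← Real.rpow_one_add' hN0.le (by intro h'; linarith)]
      ring_nf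
    have s2 := mul_le_mul_of_nonneg_left (h (N + 1)) (show 0 ≤ (N : ℝ) ^ (1 + β) by positivity)
    linarith
  have t := tail_gen β hβ a P h N hN ((N : ℝ) ^ (1 + β)) ((1 + β) * (2 / β) * (N : ℝ) ^ (-(β / 2)))
    (β / 2) (by positivity) (by positivity) (by positivity) ?_ ?_ M
  · have e : (1 + β) * (2 / β) * (N : ℝ) ^ (-(β / 2)) * ((N : ℝ) ^ (-(β / 2)) / (β / 2)) =
      (1 + β) * (2 / β) * (2 / β) * (N : ℝ) ^ (-β) := by
      have : (N : ℝ) ^ (-β) = (N : ℝ) ^ (-(β / 2)) * (N : ℝ) ^ (-(β / 2)) := by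
        rw [← Real.rpow_add hN0]; ring_nf
      rw [this]; field_simp
    rw [e] at t
    have e2 : 2 * ((N : ℝ) ^ (-β) / β) = 2 / β * (N : ℝ) ^ (-β) := by ring
    rw [e2] at t
    linarith
  · intro n hn
    have hn0 : (1 : ℝ) ≤ n := by exact_mod_cast (by omega : 1 ≤ n)
    have hn1 : (0 : ℝ) < n := by linarith
    have hk := kpow_pos β n (by omega)
    rw [Real.log_mul (by positivity) hk.ne', Real.log_rpow hN0, log_kpow β n (by omega),
      kpow_nat β n (by omega)]
    have l := log_le' (n / N) (β / 2) (by positivity) (by positivity)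
    rw [Real.log_div hn1.ne' hN0.ne', Real.div_rpow hn1.le hN0.le] at l
    have e : (n : ℝ) ^ (-1 - β / 2) = (n : ℝ) ^ (-1 - β) * (n : ℝ) ^ (β / 2) := by
      rw [← Real.rpow_add hn1]; ring_nf
    rw [e, Real.rpow_neg hN0.le]
    have hk' : 0 < (n : ℝ) ^ (-1 - β) := by positivity
    rw [mul_left_comm]
    apply mul_le_mul_of_nonneg_left _ hk'.le
    have := mul_le_mul_of_nonneg_left l (show 0 ≤ 1 + β by linarith)
    have e3 : (1 + β) * ((n : ℝ) ^ (β / 2) / (N : ℝ) ^ (β / 2) / (β / 2)) =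
      (1 + β) * (2 / β) * ((N : ℝ) ^ (β / 2))⁻¹ * (n : ℝ) ^ (β / 2) := by
      field_simp
    linarith
  · intro n hn
    have hn0 : (1 : ℝ) ≤ n := by exact_mod_cast (by omega : 1 ≤ n)
    have hn1 : (0 : ℝ) < n := by linarith
    rw [kpow_nat β n (by omega), show -1 - β = -(1 + β) by ring, Real.rpow_neg hn1.le,
      ← div_eq_mul_inv]
    apply div_le_one_of_le₀ _ (by positivity)
    apply Real.rpow_le_rpow hN0.le _ (by linarith)
    exact_mod_cast (by omega : N ≤ n)

lemma a_bound (β : ℝ) (hβ : 0 < β) (w : ℤ → ℝ) (w0 : w 0 = 0) (Q : ℝ)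
    (hQ : ∀ M, ∑ i ∈ Finset.range M, kpow β i *
      (Ups (w (i + 1) - w i - w 1) + Ups (w (-i + 1) - w (-i) - w 1)) ≤ Q)
    (l : ℕ) (t : ℝ) (ht : 0 < t) (ht1 : t ≤ 1) :
    -(w l + w (-l)) / 2 ≤ l * t + (l : ℝ) ^ (1 + β) * Q / (2 * t) := by
  have h1 : ∀ l : ℕ, -(w l + w (-l)) ≤ ∑ i ∈ Finset.range l,
      (|w (-((i + 1 : ℕ) : ℤ) + 1) - w (-((i + 1 : ℕ) : ℤ)) - w 1| + |w ((i : ℤ) + 1) - w i - w 1|) := by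
    intro l
    induction l with
    | zero => simp [w0]
    | succ n ih =>
      rw [Finset.sum_range_succ]
      have a1 := le_abs_self (w (-((n + 1 : ℕ) : ℤ) + 1) - w (-((n + 1 : ℕ) : ℤ)) - w 1)
      have a2 := neg_abs_le (w ((n : ℤ) + 1) - w n - w 1)
      have e : (-((n + 1 : ℕ) : ℤ) + 1) = -(n : ℤ) := by push_cast; ring
      rw [e] at a1 ⊢
      have e2 : ((n + 1 : ℕ) : ℤ) = (n : ℤ) + 1 := by push_cast; ring
      rw [e2] at a1 ⊢
      linarith
  have h2 : ∑ i ∈ Finset.range l, |w ((i : ℤ) + 1) - w i - w 1| ≤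
      ∑ i ∈ Finset.range l, |w (((i + 1 : ℕ) : ℤ) + 1) - w ((i + 1 : ℕ) : ℤ) - w 1| := by
    have e1 := Finset.sum_range_succ' (fun i : ℕ => |w ((i : ℤ) + 1) - w i - w 1|) l
    have e2 := Finset.sum_range_succ (fun i : ℕ => |w ((i : ℤ) + 1) - w i - w 1|) l
    simp only [Nat.cast_zero, w0, zero_add, sub_zero, sub_self, abs_zero, add_zero] at e1
    rw [← e1, e2]
    linarith [abs_nonneg (w ((l : ℤ) + 1) - w l - w 1)]
  have h3 := h1 l
  rw [Finset.sum_add_distrib] at h3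
  have h4 : -(w l + w (-l)) ≤ ∑ i ∈ Finset.range l,
      (|w (((i + 1 : ℕ) : ℤ) + 1) - w ((i + 1 : ℕ) : ℤ) - w 1| +
        |w (-((i + 1 : ℕ) : ℤ) + 1) - w (-((i + 1 : ℕ) : ℤ)) - w 1|) := by
    rw [Finset.sum_add_distrib]; linarith
  have h5 : ∀ i ∈ Finset.range l, (|w (((i + 1 : ℕ) : ℤ) + 1) - w ((i + 1 : ℕ) : ℤ) - w 1| +
        |w (-((i + 1 : ℕ) : ℤ) + 1) - w (-((i + 1 : ℕ) : ℤ)) - w 1|) ≤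
      2 * t + (l : ℝ) ^ (1 + β) / t * (kpow β ((1 + i : ℕ) : ℤ) *
        (Ups (w (((1 + i : ℕ) : ℤ) + 1) - w ((1 + i : ℕ) : ℤ) - w 1) +
          Ups (w (-((1 + i : ℕ) : ℤ) + 1) - w (-((1 + i : ℕ) : ℤ)) - w 1))) := by
    intro i hi
    rw [add_comm i 1]
    have b1 := abs_le_Ups (w (((1 + i : ℕ) : ℤ) + 1) - w ((1 + i : ℕ) : ℤ) - w 1) t ht ht1
    have b2 := abs_le_Ups (w (-((1 + i : ℕ) : ℤ) + 1) - w (-((1 + i : ℕ) : ℤ)) - w 1) t ht ht1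
    have c1 := Ups_nonneg (w (((1 + i : ℕ) : ℤ) + 1) - w ((1 + i : ℕ) : ℤ) - w 1)
    have c2 := Ups_nonneg (w (-((1 + i : ℕ) : ℤ) + 1) - w (-((1 + i : ℕ) : ℤ)) - w 1)
    have hk : 1 ≤ (l : ℝ) ^ (1 + β) * kpow β ((1 + i : ℕ) : ℤ) := by
      rw [kpow_nat β _ (by omega), show -1 - β = -(1 + β) by ring, Real.rpow_neg (by positivity),
        ← div_eq_mul_inv, one_le_div (by positivity)]
      apply Real.rpow_le_rpow (by positivity) _ (by linarith)
      have := Finset.mem_range.1 hi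
      exact_mod_cast (by omega : 1 + i ≤ l)
    set U := Ups (w (((1 + i : ℕ) : ℤ) + 1) - w ((1 + i : ℕ) : ℤ) - w 1)
    set V := Ups (w (-((1 + i : ℕ) : ℤ) + 1) - w (-((1 + i : ℕ) : ℤ)) - w 1)
    have : (U + V) / t ≤ (l : ℝ) ^ (1 + β) / t * (kpow β ((1 + i : ℕ) : ℤ) * (U + V)) := by
      have h0 : 0 ≤ (U + V) / t := by positivity
      calc (U + V) / t ≤ ((l : ℝ) ^ (1 + β) * kpow β ((1 + i : ℕ) : ℤ)) * ((U + V) / t) :=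
            le_mul_of_one_le_left h0 hk
        _ = _ := by ring
    have e : (U + V) / t = U / t + V / t := by ring
    linarith
  have h6 := h4.trans (Finset.sum_le_sum h5)
  rw [Finset.sum_add_distrib] at h6
  have h7 := sum_shift_le (fun i : ℕ => kpow β i *
      (Ups (w (i + 1) - w i - w 1) + Ups (w (-i + 1) - w (-i) - w 1)))
      (fun n => mul_nonneg (kpow_nonneg _ _) (add_nonneg (Ups_nonneg _) (Ups_nonneg _))) Q hQ 1 l
  have h8 := mul_le_mul_of_nonneg_left h7 (show 0 ≤ (l : ℝ) ^ (1 + β) / t by positivity)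
  rw [Finset.mul_sum] at h8
  simp only [Finset.sum_const, Finset.card_range, nsmul_eq_mul] at h6
  have e : (l : ℝ) ^ (1 + β) * Q / (2 * t) = ((l : ℝ) ^ (1 + β) / t * Q) / 2 := by field_simp
  rw [e]
  linarith

/-- small regime, second exponent -/
lemma small_bound_two (β : ℝ) (hβ1 : 1 < β) (hβ2 : β < 2) (K : ℝ) (hK : 0 ≤ K) :
    ∃ C : ℝ, 0 < C ∧ ∀ (a : ℕ → ℝ) (P : ℝ) (N : ℕ), 1 ≤ N →
    P ≤ (N : ℝ) ^ (-(2 + β)) →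
    (∀ M, ∑ n ∈ Finset.range M, (kpow β n) ^ 2 * Hfun (a n) ≤ P) →
    (∀ (l : ℕ) (t : ℝ), 0 < t → t ≤ 1 → a l ≤ l * t + (l : ℝ) ^ (1 + β) * (K * P) / t) →
    ∀ M, ∑ n ∈ Finset.range (N + 1 + M), kpow β n * a n ≤ C * (N : ℝ) ^ (-(β + 1 - 2 / β)) := by
  have hβ : 0 < β := by linarith
  obtain ⟨η, hη⟩ : ∃ η, η = 2 / β - 1 := ⟨_, rfl⟩
  have hη0 : 0 < η := by
    rw [hη, sub_pos, one_lt_div hβ]; exact hβ2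
  have hη1 : η < 1 := by
    have : 2 / β < 2 := by rw [div_lt_iff₀ hβ]; linarith
    linarith
  have hs : β + 1 - 2 / β = β - η := by rw [hη]; ring
  rw [hs]
  refine ⟨(1 + K) / (1 - β / 2) + ((1 + β) / η * (1 / (β - η)) + 2 / β + 2),
    by have : 0 < 1 - β / 2 := by linarith
       have : 0 < β - η := by linarith
       positivity, ?_⟩
  have hb : 0 < 1 - β / 2 := by linarith
  have hs0 : 0 < β - η := by linarith
  intro a P N hN hPN h hA M
  have hN1 : (1 : ℝ) ≤ N := by exact_mod_cast hN
  have hN0 : (0 : ℝ) < N := by linarith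
  rw [Finset.sum_range_add]
  have eβ : (N : ℝ) ^ (-β) ≤ (N : ℝ) ^ (-(β - η)) :=
    Real.rpow_le_rpow_of_exponent_le hN1 (by linarith)
  have eP : P ≤ (N : ℝ) ^ (-(β - η)) :=
    hPN.trans (Real.rpow_le_rpow_of_exponent_le hN1 (by linarith))
  have head : ∑ n ∈ Finset.range (N + 1), kpow β n * a n ≤
      (1 + K) / (1 - β / 2) * (N : ℝ) ^ (-β) := by
    rw [Finset.sum_range_succ']
    simp only [Nat.cast_zero, kpow_zero, zero_mul, add_zero]
    have hbd : ∀ i ∈ Finset.range N, kpow β ((i + 1 : ℕ) : ℤ) * a (i + 1) ≤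
        (1 + K) * (N : ℝ) ^ (-1 - β / 2) * ((i : ℝ) + 1) ^ ((1 - β / 2) - 1) := by
      intro i hi
      have hiN : ((i : ℝ) + 1) ≤ N := by
        have := Finset.mem_range.1 hi
        exact_mod_cast (by omega : i + 1 ≤ N)
      obtain ⟨x, hx⟩ : ∃ x : ℝ, x = (i : ℝ) + 1 := ⟨_, rfl⟩
      have hx1 : 1 ≤ x := by rw [hx]; linarith [Nat.cast_nonneg (α := ℝ) i]
      have hx0 : 0 < x := by linarith
      rw [← hx] at hiN ⊢
      have ht1 : (N : ℝ) ^ (-1 - β / 2) * x ^ (β / 2) ≤ 1 := by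
        calc _ ≤ (N : ℝ) ^ (-1 - β / 2) * (N : ℝ) ^ (β / 2) :=
              mul_le_mul_of_nonneg_left (Real.rpow_le_rpow hx0.le hiN (by linarith)) (by positivity)
          _ = (N : ℝ) ^ (-1 : ℝ) := by rw [← Real.rpow_add hN0]; ring_nf
          _ ≤ 1 := Real.rpow_le_one_of_one_le_of_nonpos hN1 (by norm_num)
      have := hA (i + 1) ((N : ℝ) ^ (-1 - β / 2) * x ^ (β / 2)) (by positivity) ht1
      have ex : ((i + 1 : ℕ) : ℝ) = x := by rw [hx]; push_cast; ring
      rw [ex] at this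
      rw [kpow_nat β _ (by omega), ex]
      have e1 : x * ((N : ℝ) ^ (-1 - β / 2) * x ^ (β / 2)) =
          (N : ℝ) ^ (-1 - β / 2) * x ^ (1 + β / 2) := by
        rw [Real.rpow_add hx0, Real.rpow_one]; ring
      have e2 : x ^ (1 + β) * (K * P) / ((N : ℝ) ^ (-1 - β / 2) * x ^ (β / 2)) ≤
          K * ((N : ℝ) ^ (-1 - β / 2) * x ^ (1 + β / 2)) := by
        rw [div_le_iff₀ (by positivity)]
        have f1 : x ^ (1 + β) = x ^ (1 + β / 2) * x ^ (β / 2) := by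
          rw [← Real.rpow_add hx0]; ring_nf
        have f2 : (N : ℝ) ^ (-(2 + β)) = (N : ℝ) ^ (-1 - β / 2) * (N : ℝ) ^ (-1 - β / 2) := by
          rw [← Real.rpow_add hN0]; ring_nf
        rw [f2] at hPN
        rw [f1]
        calc x ^ (1 + β / 2) * x ^ (β / 2) * (K * P)
            ≤ x ^ (1 + β / 2) * x ^ (β / 2) * (K * ((N : ℝ) ^ (-1 - β / 2) * (N : ℝ) ^ (-1 - β / 2))) := by
              gcongr
          _ = _ := by ring
      have e3 : a (i + 1) ≤ (1 + K) * ((N : ℝ) ^ (-1 - β / 2) * x ^ (1 + β / 2)) := by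
        linarith
      calc x ^ (-1 - β) * a (i + 1)
          ≤ x ^ (-1 - β) * ((1 + K) * ((N : ℝ) ^ (-1 - β / 2) * x ^ (1 + β / 2))) :=
            mul_le_mul_of_nonneg_left e3 (by positivity)
        _ = (1 + K) * (N : ℝ) ^ (-1 - β / 2) * (x ^ (-1 - β) * x ^ (1 + β / 2)) := by ring
        _ = _ := by rw [← Real.rpow_add hx0]; ring_nf
    refine (Finset.sum_le_sum hbd).trans ?_
    rw [← Finset.mul_sum]
    have := mul_le_mul_of_nonneg_left (head_sum (1 - β / 2) hb (by linarith) N)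
      (show 0 ≤ (1 + K) * (N : ℝ) ^ (-1 - β / 2) by positivity)
    refine this.trans (le_of_eq ?_)
    have f : (N : ℝ) ^ (-β) = (N : ℝ) ^ (-1 - β / 2) * (N : ℝ) ^ (1 - β / 2) := by
      rw [← Real.rpow_add hN0]; ring_nf
    rw [f]; ring
  have t := tail_gen β hβ a P h N hN 1 ((1 + β) / η) (β - η) one_pos hs0 (by positivity) ?_ ?_ M
  · have e1 : (1 + β) / η * ((N : ℝ) ^ (-(β - η)) / (β - η)) =
      (1 + β) / η * (1 / (β - η)) * (N : ℝ) ^ (-(β - η)) := by ring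
    have e2 : 2 * ((N : ℝ) ^ (-β) / β) = 2 / β * (N : ℝ) ^ (-β) := by ring
    have e3 : 2 / β * (N : ℝ) ^ (-β) ≤ 2 / β * (N : ℝ) ^ (-(β - η)) :=
      mul_le_mul_of_nonneg_left eβ (by positivity)
    have e4 : (1 + K) / (1 - β / 2) * (N : ℝ) ^ (-β) ≤ (1 + K) / (1 - β / 2) * (N : ℝ) ^ (-(β - η)) :=
      mul_le_mul_of_nonneg_left eβ (by positivity)
    rw [e1, e2] at t
    linarith
  · intro n hn
    have hn0 : (1 : ℝ) ≤ n := by exact_mod_cast (by omega : 1 ≤ n)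
    have hn1 : (0 : ℝ) < n := by linarith
    rw [one_mul, log_kpow β n (by omega), kpow_nat β n (by omega)]
    have l := log_le' n η hn1.le hη0
    have e : (n : ℝ) ^ (-1 - (β - η)) = (n : ℝ) ^ (-1 - β) * (n : ℝ) ^ η := by
      rw [← Real.rpow_add hn1]; ring_nf
    rw [e, mul_left_comm]
    apply mul_le_mul_of_nonneg_left _ (by positivity)
    have := mul_le_mul_of_nonneg_left l (show 0 ≤ 1 + β by linarith)
    have e3 : (1 + β) * ((n : ℝ) ^ η / η) = (1 + β) / η * (n : ℝ) ^ η := by ring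
    linarith
  · intro n hn
    have hn0 : (1 : ℝ) ≤ n := by exact_mod_cast (by omega : 1 ≤ n)
    rw [kpow_nat β n (by omega), one_mul]
    exact Real.rpow_le_one_of_one_le_of_nonpos hn0 (by linarith)

/-- the terms of `Psi2` in terms of `v = u (x + ·) - u x`. -/
def Tterm (β : ℝ) (v : ℤ → ℝ) (p : ℤ × ℤ) : ℝ :=
  kpow β p.1 * kpow β p.2 * Real.exp (v p.2) * Ups (v (p.1 + p.2) - v p.1 - v p.2)

lemma Psi2_eq (β : ℝ) (u : ℤ → ℝ) (x : ℤ) :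
    Psi2 (kpow β) u x = (1 / 2) * ∑' p, Tterm β (fun j => u (x + j) - u x) p := by
  unfold Psi2 Tterm
  congr 2
  ext p
  simp only [add_assoc]
  congr 2
  ring

lemma Tterm_nonneg (β : ℝ) (v : ℤ → ℝ) (p : ℤ × ℤ) : 0 ≤ Tterm β v p :=
  mul_nonneg (mul_nonneg (mul_nonneg (kpow_nonneg _ _) (kpow_nonneg _ _)) (Real.exp_pos _).le)
    (Ups_nonneg _)

lemma Tterm_summable (β : ℝ) (hβ : 0 < β) (v : ℤ → ℝ) (B : ℝ) (hv : ∀ j, |v j| ≤ B) :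
    Summable (Tterm β v) := by
  have hk := kpow_summable β hβ
  have h2 : Summable (fun p : ℤ × ℤ => kpow β p.1 * kpow β p.2) :=
    hk.mul_of_nonneg hk (fun j => kpow_nonneg β j) (fun j => kpow_nonneg β j)
  refine Summable.of_nonneg_of_le (Tterm_nonneg β v) (fun p => ?_)
    (h2.mul_right (Real.exp B * (Real.exp (3 * B) + 3 * B)))
  unfold Tterm
  rw [mul_assoc]
  apply mul_le_mul_of_nonneg_left _ (mul_nonneg (kpow_nonneg _ _) (kpow_nonneg _ _))
  have a1 := abs_le.1 (hv p.1)
  have a2 := abs_le.1 (hv p.2)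
  have a3 := abs_le.1 (hv (p.1 + p.2))
  apply mul_le_mul _ _ (Ups_nonneg _) (Real.exp_pos _).le
  · exact Real.exp_le_exp.2 a2.2
  · unfold Ups
    have : Real.exp (v (p.1 + p.2) - v p.1 - v p.2) ≤ Real.exp (3 * B) :=
      Real.exp_le_exp.2 (by linarith)
    linarith

lemma extract (f : ℤ × ℤ → ℝ) (hf : Summable f) (hn : ∀ p, 0 ≤ f p) (i : ℤ → ℤ × ℤ)
    (hi : Function.Injective i) (h0 : f (i 0) = 0) (M : ℕ) :
    ∑ n ∈ Finset.range M, (f (i n) + f (i (-n))) ≤ ∑' p, f p := by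
  have hs : Summable (f ∘ i) := hf.comp_injective hi
  have h1 := tsum_comp_le_tsum_of_inj hf hn hi
  have h2 := hs.hasSum.nat_add_neg
  have h3 := h2.summable.sum_le_tsum (Finset.range M) (fun n _ => add_nonneg (hn _) (hn _))
  replace h3 := h3.trans_eq h2.tsum_eq
  simp only [Function.comp_apply, h0, add_zero] at h3
  exact h3.trans h1

lemma extract_diag (β : ℝ) (hβ : 0 < β) (v : ℤ → ℝ) (v0 : v 0 = 0) (B : ℝ) (hv : ∀ j, |v j| ≤ B)
    (M : ℕ) : ∑ n ∈ Finset.range M, (kpow β n) ^ 2 * Hfun (-(v n + v (-n)) / 2) ≤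
      (1 / 2) * ∑' p, Tterm β v p := by
  have h := extract _ (Tterm_summable β hβ v B hv) (Tterm_nonneg β v) (fun j => (-j, j))
    (fun a b hab => by simpa using congrArg Prod.snd hab) (by simp [Tterm, kpow_zero]) M
  have h2 : ∀ n ∈ Finset.range M, 2 * ((kpow β n) ^ 2 * Hfun (-(v n + v (-n)) / 2)) ≤
      Tterm β v (-(n : ℤ), (n : ℤ)) + Tterm β v (-(-(n : ℤ)), -(n : ℤ)) := by
    intro n _
    unfold Tterm Hfun
    simp only [neg_neg, neg_add_cancel, add_neg_cancel, v0, kpow_neg]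
    have e1 : (0 : ℝ) - v (-n) - v n = -(v n + v (-n)) := by ring
    have e2 : (0 : ℝ) - v n - v (-n) = -(v n + v (-n)) := by ring
    have e3 : 2 * (-(v n + v (-n)) / 2) = -(v n + v (-n)) := by ring
    rw [e1, e2, e3]
    have hU := Ups_nonneg (-(v n + v (-n)))
    have hE : 2 * Real.exp (-(-(v n + v (-n)) / 2)) ≤ Real.exp (v n) + Real.exp (v (-n)) := by
      have f1 : Real.exp (v n) = Real.exp (v n / 2) ^ 2 := by
        rw [← Real.exp_nat_mul]; congr 1; push_cast; ring
      have f2 : Real.exp (v (-n)) = Real.exp (v (-n) / 2) ^ 2 := by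
        rw [← Real.exp_nat_mul]; congr 1; push_cast; ring
      have f3 : Real.exp (-(-(v n + v (-n)) / 2)) = Real.exp (v n / 2) * Real.exp (v (-n) / 2) := by
        rw [← Real.exp_add]; congr 1; ring
      rw [f1, f2, f3]
      nlinarith [sq_nonneg (Real.exp (v n / 2) - Real.exp (v (-n) / 2))]
    have hq : 0 ≤ (kpow β n) ^ 2 * Ups (-(v n + v (-n))) := mul_nonneg (sq_nonneg _) hU
    have hE2 : Real.exp (-(-(v n + v (-n)) / 2)) ≤ Real.exp (v n) + Real.exp (v (-n)) := by
      linarith [Real.exp_pos (-(-(v n + v (-n)) / 2))]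
    calc _ = Real.exp (-(-(v n + v (-n)) / 2)) * ((kpow β n) ^ 2 * Ups (-(v n + v (-n)))) := by ring
      _ ≤ (Real.exp (v n) + Real.exp (v (-n))) * ((kpow β n) ^ 2 * Ups (-(v n + v (-n)))) :=
        mul_le_mul_of_nonneg_right hE2 hq
      _ = _ := by ring
  have h3 := (Finset.sum_le_sum h2).trans h
  rw [← Finset.mul_sum] at h3
  linarith

lemma extract_one (β : ℝ) (hβ : 0 < β) (v : ℤ → ℝ) (B : ℝ) (hv : ∀ j, |v j| ≤ B)
    (s : ℤ) (hs : s = 1 ∨ s = -1) (M : ℕ) :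
    ∑ n ∈ Finset.range M, kpow β n * (Ups (v (s * (n + 1)) - v (s * n) - v (s * 1)) +
      Ups (v (s * (-n + 1)) - v (s * (-n)) - v (s * 1))) * Real.exp (v s) ≤
      ∑' p, Tterm β v p := by
  have h := extract _ (Tterm_summable β hβ v B hv) (Tterm_nonneg β v) (fun j => (s * j, s))
    (fun a b hab => by
      have := congrArg Prod.fst hab
      rcases hs with rfl | rfl <;> simpa using this) (by simp [Tterm, kpow_zero]) M
  refine le_trans (le_of_eq (Finset.sum_congr rfl fun n _ => ?_)) h
  unfold Tterm
  have hk : kpow β s = 1 := by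
    rcases hs with rfl | rfl
    · exact kpow_one β
    · rw [kpow_neg]; exact kpow_one β
  have hk2 : kpow β (s * n) = kpow β n := by
    rcases hs with rfl | rfl
    · simp
    · simp [kpow_neg]
  have hk3 : kpow β (s * -n) = kpow β n := by
    rw [mul_neg, kpow_neg, hk2]
  simp only [hk, hk2, hk3]
  rw [show s * ((n : ℤ) + 1) = s * n + s by ring, show s * (-(n : ℤ) + 1) = s * (-n) + s by ring, mul_one]
  ring

lemma diag_sequence_bound (β : ℝ) (hβ : 0 < β) (v : ℤ → ℝ) (v0 : v 0 = 0) (B : ℝ)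
    (hv : ∀ j, |v j| ≤ B) (P : ℝ) (hP : P = (1 / 2) * ∑' p, Tterm β v p) (hP1 : P ≤ 1)
    (l : ℕ) (t : ℝ) (ht : 0 < t) (ht1 : t ≤ 1) :
    -(v l + v (-l)) / 2 ≤ l * t + (l : ℝ) ^ (1 + β) * (Real.exp 2 * P) / t := by
  have hd := extract_diag β hβ v v0 B hv 2
  rw [← hP] at hd
  simp only [Finset.sum_range_succ, Finset.sum_range_zero, Nat.cast_zero, Nat.cast_one,
      kpow_zero, kpow_one] at hd
  have hsq := Hfun_ge_sq (-(v 1 + v (-1)) / 2)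
  have ha : -(v 1 + v (-1)) / 2 ≤ 2 := by nlinarith
  have : ∃ s : ℤ, (s = 1 ∨ s = -1) ∧ -2 ≤ v s := by
    by_cases h : -2 ≤ v 1
    · exact ⟨1, Or.inl rfl, h⟩
    · exact ⟨-1, Or.inr rfl, by push Not at h; linarith⟩
  obtain ⟨s, hs, hvs⟩ := this
  have hQ : ∀ M, ∑ n ∈ Finset.range M, kpow β n * (Ups (v (s * (n + 1)) - v (s * n) - v (s * 1)) +
      Ups (v (s * (-n + 1)) - v (s * (-n)) - v (s * 1))) ≤ 2 * Real.exp 2 * P := by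
    intro M
    have h := extract_one β hβ v B hv s hs M
    rw [← Finset.sum_mul] at h
    set S := ∑ n ∈ Finset.range M, kpow β n * (Ups (v (s * (n + 1)) - v (s * n) - v (s * 1)) +
      Ups (v (s * (-n + 1)) - v (s * (-n)) - v (s * 1))) with hS
    have hS0 : 0 ≤ S := Finset.sum_nonneg fun n _ =>
      mul_nonneg (kpow_nonneg _ _) (add_nonneg (Ups_nonneg _) (Ups_nonneg _))
    have h1 : S * Real.exp (-2) ≤ 2 * P := by
      have := mul_le_mul_of_nonneg_left (Real.exp_le_exp.2 hvs) hS0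
      linarith
    have h2 : Real.exp (-2) * Real.exp 2 = 1 := by rw [← Real.exp_add]; simp
    have h3 := mul_le_mul_of_nonneg_right h1 (Real.exp_pos 2).le
    rw [mul_assoc, h2] at h3
    linarith
  have key := a_bound β hβ (fun i => v (s * i)) (by simpa using v0) _ hQ l t ht ht1
  have e1 : v (s * l) + v (s * -l) = v l + v (-l) := by
    rcases hs with rfl | rfl
    · simp
    · simp [add_comm]
  simp only [e1] at key
  refine key.trans (le_of_eq ?_)
  field_simp

lemma Lop_bound (β : ℝ) (hβ : 0 < β) (u : ℤ → ℝ) (x : ℤ) (B : ℝ)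
    (hv : ∀ j, |u (x + j) - u x| ≤ B) (A : ℝ) (N : ℕ)
    (h : ∀ M, ∑ n ∈ Finset.range (N + M), kpow β n *
      (-((u (x + n) - u x) + (u (x + -n) - u x)) / 2) ≤ A) :
    -Lop (kpow β) u x ≤ 2 * A := by
  have hs : Summable (fun j : ℤ => kpow β j * (u (x + j) - u x)) := by
    refine Summable.of_norm_bounded ((kpow_summable β hβ).mul_right B) (fun j => ?_)
    rw [norm_mul, Real.norm_eq_abs, Real.norm_eq_abs, abs_of_nonneg (kpow_nonneg β j)]
    exact mul_le_mul_of_nonneg_left (hv j) (kpow_nonneg β j)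
  have h1 := hs.hasSum.nat_add_neg
  rw [kpow_zero, zero_mul, add_zero] at h1
  have h2 := (h1.tendsto_sum_nat).comp (tendsto_add_atTop_nat N)
  have h3 : -(2 * A) ≤ Lop (kpow β) u x := by
    refine ge_of_tendsto' h2 (fun M => ?_)
    have := h M
    simp only [Function.comp_apply]
    rw [add_comm M N]
    have e : ∑ i ∈ Finset.range (N + M), (kpow β i * (u (x + i) - u x) +
        kpow β (-i) * (u (x + -i) - u x)) = -2 * ∑ n ∈ Finset.range (N + M), kpow β n *
      (-((u (x + n) - u x) + (u (x + -n) - u x)) / 2) := by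
      rw [Finset.mul_sum]
      refine Finset.sum_congr rfl fun n _ => ?_
      rw [kpow_neg]; ring
    rw [e]; linarith
  linarith

lemma nat_to_rpow (q s C : ℝ) (hq : 0 < q) (hs : 0 < s) (hC : 0 < C) (P r : ℝ) (hP0 : 0 ≤ P)
    (hP1 : P ≤ 1) (h : ∀ N : ℕ, 1 ≤ N → P ≤ (N : ℝ) ^ (-q) → r ≤ C * (N : ℝ) ^ (-s)) :
    r ≤ C * 2 ^ s * P ^ (s / q) := by
  rcases hP0.eq_or_lt with rfl | hP
  · rw [Real.zero_rpow (by positivity), mul_zero]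
    have h1 : Tendsto (fun N : ℕ => C * (N : ℝ) ^ (-s)) atTop (nhds (C * 0)) :=
      ((tendsto_rpow_neg_atTop hs).comp tendsto_natCast_atTop_atTop).const_mul C
    rw [mul_zero] at h1
    refine ge_of_tendsto h1 ?_
    filter_upwards [eventually_ge_atTop 1] with N hN
    exact h N hN (by positivity)
  · obtain ⟨y, hy⟩ : ∃ y, y = P ^ (-1 / q) := ⟨_, rfl⟩
    have hy1 : 1 ≤ y := by
      rw [hy]; exact Real.one_le_rpow_of_pos_of_le_one_of_nonpos hP hP1
        (by rw [neg_div]; simp; positivity)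
    have hy0 : 0 < y := by linarith
    have hN : 1 ≤ ⌊y⌋₊ := Nat.le_floor (by simpa using hy1)
    have hN' : (1 : ℝ) ≤ (⌊y⌋₊ : ℝ) := by exact_mod_cast hN
    have hNy : (⌊y⌋₊ : ℝ) ≤ y := Nat.floor_le hy0.le
    have hyN : y < (⌊y⌋₊ : ℝ) + 1 := Nat.lt_floor_add_one y
    have e1 : y ^ (-q) = P := by
      rw [hy, ← Real.rpow_mul hP0]
      rw [show -1 / q * -q = 1 by field_simp, Real.rpow_one]
    have e2 : y ^ (-s) = P ^ (s / q) := by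
      rw [hy, ← Real.rpow_mul hP0]
      congr 1; field_simp
    have h1 := h ⌊y⌋₊ hN (by
      rw [← e1]; exact Real.rpow_le_rpow_of_nonpos (by linarith) hNy (by linarith))
    refine h1.trans ?_
    rw [mul_assoc]
    apply mul_le_mul_of_nonneg_left _ hC.le
    calc (⌊y⌋₊ : ℝ) ^ (-s) ≤ (y / 2) ^ (-s) :=
          Real.rpow_le_rpow_of_nonpos (by linarith) (by linarith) (by linarith)
      _ = 2 ^ s * y ^ (-s) := by
          rw [Real.div_rpow hy0.le (by norm_num), Real.rpow_neg (by norm_num : (0:ℝ) ≤ 2)]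
          field_simp
      _ = _ := by rw [e2]

def FCD (c ν p : ℝ) (r : ℝ) : ℝ := c * (Real.exp (ν * r) - 1) ^ p

lemma exp_sub_pos (ν r : ℝ) (hν : 0 < ν) (hr : 0 < r) : 0 < Real.exp (ν * r) - 1 := by
  have := Real.add_one_le_exp (ν * r)
  have : 0 < ν * r := by positivity
  linarith

lemma FCD_isCD (c ν p : ℝ) (hc : 0 < c) (hν : 0 < ν) (hp : 1 < p) : IsCDFunction (FCD c ν p) := by
  refine ⟨?_, ?_, ?_, ?_, ?_⟩
  · apply Continuous.continuousOn
    unfold FCD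
    apply Continuous.mul continuous_const
    apply Continuous.rpow_const (by fun_prop)
    intro x; right; linarith
  · intro r hr
    unfold FCD
    have := Real.add_one_le_exp (ν * r)
    have h2 : 0 ≤ ν * r := by positivity
    have : 0 ≤ Real.exp (ν * r) - 1 := by linarith
    positivity
  · simp [FCD, Real.zero_rpow (by linarith : p ≠ 0)]
  · intro x hx y hy hxy
    have hx0 : 0 < x := hx
    have hy0 : 0 < y := hy
    have ex := exp_sub_pos ν x hν hx0
    have ey := exp_sub_pos ν y hν hy0
    have key : (Real.exp (ν * x) - 1) / x ≤ (Real.exp (ν * y) - 1) / y := by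
      have := convexOn_exp.2 (Set.mem_univ (ν * y)) (Set.mem_univ 0)
        (show 0 ≤ x / y by positivity) (show 0 ≤ 1 - x / y by
          rw [sub_nonneg, div_le_one hy0]; exact hxy.le) (by ring)
      simp only [smul_eq_mul, mul_zero, add_zero, Real.exp_zero, mul_one] at this
      rw [show x / y * (ν * y) = ν * x by field_simp] at this
      rw [div_le_iff₀ hx0]
      have e : (Real.exp (ν * y) - 1) / y * x = x / y * Real.exp (ν * y) - x / y := by ring
      rw [e]; linarith
    have key2 : (Real.exp (ν * x) - 1) ^ (p - 1) < (Real.exp (ν * y) - 1) ^ (p - 1) := by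
      apply Real.rpow_lt_rpow ex.le _ (by linarith)
      have := Real.exp_lt_exp.2 (mul_lt_mul_of_pos_left hxy hν)
      linarith
    have rw1 : ∀ z, 0 < Real.exp (ν * z) - 1 → FCD c ν p z / z =
        c * ((Real.exp (ν * z) - 1) / z * (Real.exp (ν * z) - 1) ^ (p - 1)) := by
      intro z hz
      unfold FCD
      rw [Real.rpow_sub_one hz.ne']; field_simp
    simp only
    rw [rw1 x ex, rw1 y ey]
    apply mul_lt_mul_of_pos_left _ hc
    apply mul_lt_mul' key key2 (by positivity) (by positivity)
  · refine ⟨1, one_pos, ?_⟩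
    have hd : 0 < 1 - Real.exp (-ν) := by
      have : Real.exp (-ν) < 1 := by
        have h := Real.exp_lt_exp.2 (show -ν < 0 by linarith)
        rwa [Real.exp_zero] at h
      linarith
    have hI : MeasureTheory.IntegrableOn (fun r : ℝ => (c * (1 - Real.exp (-ν)) ^ p)⁻¹ *
        Real.exp (-(p * ν) * r)) (Ici 1) := by
      apply MeasureTheory.Integrable.const_mul
      refine (integrableOn_Ici_iff_integrableOn_Ioi (by simp)).2 ?_
      exact exp_neg_integrableOn_Ioi 1 (by positivity)
    refine MeasureTheory.Integrable.mono' hI ?_ ?_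
    · apply Measurable.aestronglyMeasurable
      unfold FCD
      fun_prop
    · refine (MeasureTheory.ae_restrict_iff' measurableSet_Ici).2 (Eventually.of_forall ?_)
      intro r hr
      have hr1 : 1 ≤ r := hr
      have er := exp_sub_pos ν r hν (by linarith)
      have hF : 0 < FCD c ν p r := by unfold FCD; positivity
      rw [Real.norm_eq_abs, abs_of_nonneg (by positivity)]
      have h1 : (1 - Real.exp (-ν)) * Real.exp (ν * r) ≤ Real.exp (ν * r) - 1 := by
        have : 1 ≤ Real.exp (-ν) * Real.exp (ν * r) := by
          rw [← Real.exp_add]; apply Real.one_le_exp; nlinarith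
        linarith
      have h2 : c * (1 - Real.exp (-ν)) ^ p * Real.exp (p * ν * r) ≤ FCD c ν p r := by
        unfold FCD
        rw [mul_assoc]
        apply mul_le_mul_of_nonneg_left _ hc.le
        have := Real.rpow_le_rpow (by positivity) h1 (by linarith : 0 ≤ p)
        rw [Real.mul_rpow hd.le (Real.exp_pos _).le, ← Real.exp_mul] at this
        rwa [show ν * r * p = p * ν * r by ring] at this
      rw [neg_mul, Real.exp_neg (p * ν * r), ← mul_inv, one_div]
      exact inv_anti₀ (by positivity) h2

lemma FCD_zero (c ν p : ℝ) (hc : 0 < c) (hν : 0 < ν) :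
    Tendsto (fun x => FCD c ν p x / (c * ν ^ p * x ^ p)) (nhdsWithin 0 (Ioi 0)) (nhds 1) := by
  have hd : HasDerivAt (fun x => Real.exp (ν * x)) ν 0 := by
    have := ((hasDerivAt_id (0 : ℝ)).const_mul ν).exp
    simpa using this
  have h1 := hd.tendsto_slope_zero_right
  simp only [zero_add, mul_zero, Real.exp_zero, smul_eq_mul] at h1
  have h2 : Tendsto (fun t => (ν⁻¹ * (t⁻¹ * (Real.exp (ν * t) - 1))) ^ p) (nhdsWithin 0 (Ioi 0))
      (nhds ((ν⁻¹ * ν) ^ p)) := by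
    apply (h1.const_mul ν⁻¹).rpow_const
    left; field_simp; norm_num
  rw [inv_mul_cancel₀ hν.ne', Real.one_rpow] at h2
  refine h2.congr' ?_
  filter_upwards [self_mem_nhdsWithin] with x hx
  have hx0 : 0 < x := hx
  have ex := exp_sub_pos ν x hν hx0
  unfold FCD
  rw [Real.mul_rpow (by positivity) (by positivity), Real.mul_rpow (by positivity) (by positivity),
    Real.inv_rpow hν.le, Real.inv_rpow hx0.le]
  field_simp

lemma FCD_top (c ν p : ℝ) (hc : 0 < c) (hν : 0 < ν) :
    Tendsto (fun x => FCD c ν p x / (c * Real.exp (p * ν * x))) atTop (nhds 1) := by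
  have h0 : Tendsto (fun x : ℝ => Real.exp (-(ν * x))) atTop (nhds 0) :=
    Real.tendsto_exp_neg_atTop_nhds_zero.comp (tendsto_id.const_mul_atTop hν)
  have h2 : Tendsto (fun x : ℝ => (1 - Real.exp (-(ν * x))) ^ p) atTop (nhds ((1 - 0) ^ p)) := by
    apply (h0.const_sub 1).rpow_const
    left; norm_num
  rw [sub_zero, Real.one_rpow] at h2
  refine h2.congr' ?_
  filter_upwards [eventually_gt_atTop 0] with x hx
  have ex := exp_sub_pos ν x hν hx
  unfold FCD
  rw [show p * ν * x = ν * x * p by ring, Real.exp_mul (ν * x) p, mul_div_mul_left _ _ hc.ne',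
    ← Real.div_rpow ex.le (Real.exp_pos _).le]
  congr 1
  rw [Real.exp_neg]
  have := Real.exp_pos (ν * x)
  field_simp

lemma assemble (k : ℤ → ℝ) (p C : ℝ) (hp : 1 < p) (hC : 0 < C)
    (h : ∀ u : ℤ → ℝ, BddFun u → ∀ x : ℤ, 0 ≤ Psi2 k u x ∧
      (Psi2 k u x ≤ 1 → -Lop k u x ≤ C * Psi2 k u x ^ (1 / p)) ∧
      (1 ≤ Psi2 k u x → -Lop k u x ≤ C * (1 + Real.log (Psi2 k u x)))) :
    ∃ c₁ c₂ ν : ℝ, 0 < c₁ ∧ 0 < c₂ ∧ 0 < ν ∧ ∃ F : ℝ → ℝ,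
        IsCDFunction F ∧ CDUps k F ∧
        Tendsto (fun x => F x / (c₁ * x ^ p)) (nhdsWithin 0 (Ioi 0)) (nhds 1) ∧
        Tendsto (fun x => F x / (c₂ * Real.exp (ν * x))) atTop (nhds 1) := by
  have hp0 : 0 < p := by linarith
  obtain ⟨ν, hν⟩ : ∃ ν, ν = 1 / (p * C) := ⟨_, rfl⟩
  have hν0 : 0 < ν := by rw [hν]; positivity
  obtain ⟨Z, hZ⟩ : ∃ Z, Z = (ν * C * Real.exp (ν * C)) ^ p := ⟨_, rfl⟩
  have hZ0 : 0 < Z := by rw [hZ]; positivity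
  obtain ⟨c, hc⟩ : ∃ c, c = min Z⁻¹ (Real.exp (-1)) := ⟨_, rfl⟩
  have hc0 : 0 < c := by rw [hc]; exact lt_min (by positivity) (Real.exp_pos _)
  refine ⟨c * ν ^ p, c, p * ν, by positivity, hc0, by positivity, FCD c ν p,
    FCD_isCD c ν p hc0 hν0 hp, ?_, FCD_zero c ν p hc0 hν0, FCD_top c ν p hc0 hν0⟩
  intro u hu x hr
  obtain ⟨h0, h1, h2⟩ := h u hu x
  set r := -Lop k u x
  set P := Psi2 k u x
  have er : 0 ≤ Real.exp (ν * r) - 1 := by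
    have := Real.one_le_exp (show 0 ≤ ν * r by positivity)
    linarith
  unfold FCD
  rcases le_total P 1 with hP | hP
  · have hr2 := h1 hP
    have hPp : P ^ (1 / p) ≤ 1 := Real.rpow_le_one h0 hP (by positivity)
    have hy : Real.exp (ν * r) - 1 ≤ ν * C * Real.exp (ν * C) * P ^ (1 / p) := by
      have a1 : Real.exp (ν * r) - 1 ≤ ν * r * Real.exp (ν * r) := by
        have b1 := Real.add_one_le_exp (-(ν * r))
        have b2 : Real.exp (-(ν * r)) * Real.exp (ν * r) = 1 := by rw [← Real.exp_add]; simp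
        have := mul_le_mul_of_nonneg_right b1 (Real.exp_pos (ν * r)).le
        linarith
      have a3 : r ≤ C := hr2.trans (by nlinarith)
      have a2 : Real.exp (ν * r) ≤ Real.exp (ν * C) :=
        Real.exp_le_exp.2 (mul_le_mul_of_nonneg_left a3 hν0.le)
      calc _ ≤ ν * r * Real.exp (ν * r) := a1
        _ ≤ ν * (C * P ^ (1 / p)) * Real.exp (ν * C) := by gcongr
        _ = _ := by ring
    have hz : (Real.exp (ν * r) - 1) ^ p ≤ Z * P := by
      have := Real.rpow_le_rpow er hy hp0.le
      rwa [Real.mul_rpow (by positivity) (by positivity), ← hZ, ← Real.rpow_mul h0,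
        one_div_mul_cancel hp0.ne', Real.rpow_one] at this
    calc c * (Real.exp (ν * r) - 1) ^ p ≤ Z⁻¹ * (Z * P) := by
          apply mul_le_mul _ hz (by positivity) (by positivity)
          rw [hc]; exact min_le_left _ _
      _ = P := by field_simp
  · have hr2 := h2 hP
    have hP0 : 0 < P := by linarith
    have hz : (Real.exp (ν * r) - 1) ^ p ≤ Real.exp 1 * P := by
      calc _ ≤ (Real.exp (ν * r)) ^ p := Real.rpow_le_rpow er (by linarith) hp0.le
        _ = Real.exp (ν * r * p) := by rw [Real.exp_mul (ν * r) p]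
        _ ≤ Real.exp (1 + Real.log P) := by
          apply Real.exp_le_exp.2
          calc ν * r * p ≤ ν * (C * (1 + Real.log P)) * p := by gcongr
            _ = 1 + Real.log P := by rw [hν]; field_simp
        _ = _ := by rw [Real.exp_add, Real.exp_log hP0]
    calc c * (Real.exp (ν * r) - 1) ^ p ≤ Real.exp (-1) * (Real.exp 1 * P) := by
          apply mul_le_mul _ hz (by positivity) (by positivity)
          rw [hc]; exact min_le_right _ _
      _ = P := by rw [← mul_assoc, ← Real.exp_add]; simp

lemma bdd_shift (u : ℤ → ℝ) (hu : BddFun u) (x : ℤ) : ∃ B, ∀ j, |u (x + j) - u x| ≤ B := by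
  obtain ⟨M, hM⟩ := hu
  exact ⟨M + M, fun j => (abs_sub _ _).trans (add_le_add (hM _) (hM _))⟩

lemma Psi2_nonneg (β : ℝ) (u : ℤ → ℝ) (x : ℤ) : 0 ≤ Psi2 (kpow β) u x := by
  rw [Psi2_eq]
  exact mul_nonneg (by norm_num) (tsum_nonneg fun p => Tterm_nonneg β _ p)

lemma psi_diag (β : ℝ) (hβ : 0 < β) (u : ℤ → ℝ) (hu : BddFun u) (x : ℤ) (M : ℕ) :
    ∑ n ∈ Finset.range M, (kpow β n) ^ 2 *
      Hfun (-((u (x + n) - u x) + (u (x + -n) - u x)) / 2) ≤ Psi2 (kpow β) u x := by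
  obtain ⟨B, hB⟩ := bdd_shift u hu x
  rw [Psi2_eq]
  exact extract_diag β hβ (fun j => u (x + j) - u x) (by simp) B hB M

lemma large_final (β : ℝ) (hβ : 0 < β) : ∃ C : ℝ, 0 < C ∧ ∀ u : ℤ → ℝ, BddFun u → ∀ x : ℤ,
    1 ≤ Psi2 (kpow β) u x → -Lop (kpow β) u x ≤ C * (1 + Real.log (Psi2 (kpow β) u x)) := by
  obtain ⟨C, hC, h⟩ := large_bound β hβ
  refine ⟨2 * C, by positivity, fun u hu x hP => ?_⟩
  obtain ⟨B, hB⟩ := bdd_shift u hu x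
  have := Lop_bound β hβ u x B hB _ 2 (h (fun n : ℕ => -((u (x + n) - u x) + (u (x + -n) - u x)) / 2)
    _ hP (psi_diag β hβ u hu x))
  linarith

lemma small_final_one (β : ℝ) (hβ : 0 < β) : ∃ C : ℝ, 0 < C ∧ ∀ u : ℤ → ℝ, BddFun u → ∀ x : ℤ,
    Psi2 (kpow β) u x ≤ 1 → -Lop (kpow β) u x ≤ C * (Psi2 (kpow β) u x) ^ (β / (1 + 2 * β)) := by
  obtain ⟨C, hC, h⟩ := small_bound_one β hβ
  refine ⟨2 * C * 2 ^ β, by positivity, fun u hu x hP => ?_⟩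
  obtain ⟨B, hB⟩ := bdd_shift u hu x
  refine nat_to_rpow (1 + 2 * β) β (2 * C) (by positivity) hβ (by positivity) _ _
    (Psi2_nonneg β u x) hP (fun N hN hPN => ?_)
  have := Lop_bound β hβ u x B hB _ (N + 1)
    (h (fun n : ℕ => -((u (x + n) - u x) + (u (x + -n) - u x)) / 2)
    _ N hN hPN (psi_diag β hβ u hu x))
  linarith

lemma small_final_two (β : ℝ) (hβ1 : 1 < β) (hβ2 : β < 2) : ∃ C : ℝ, 0 < C ∧
    ∀ u : ℤ → ℝ, BddFun u → ∀ x : ℤ,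
    Psi2 (kpow β) u x ≤ 1 → -Lop (kpow β) u x ≤ C * (Psi2 (kpow β) u x) ^ ((β - 1) / β) := by
  have hβ : 0 < β := by linarith
  obtain ⟨C, hC, h⟩ := small_bound_two β hβ1 hβ2 (Real.exp 2) (Real.exp_pos 2).le
  have hs : 0 < β + 1 - 2 / β := by
    have : 2 / β < 2 := by rw [div_lt_iff₀ hβ]; linarith
    linarith
  refine ⟨2 * C * 2 ^ (β + 1 - 2 / β), by positivity, fun u hu x hP => ?_⟩
  obtain ⟨B, hB⟩ := bdd_shift u hu x
  have e : (β - 1) / β = (β + 1 - 2 / β) / (2 + β) := by field_simp; ring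
  rw [e]
  refine nat_to_rpow (2 + β) (β + 1 - 2 / β) (2 * C) (by positivity) hs (by positivity) _ _
    (Psi2_nonneg β u x) hP (fun N hN hPN => ?_)
  have := Lop_bound β hβ u x B hB _ (N + 1)
    (h (fun n : ℕ => -((u (x + n) - u x) + (u (x + -n) - u x)) / 2)
    _ N hN hPN (psi_diag β hβ u hu x) (fun l t ht ht1 =>
      diag_sequence_bound β hβ (fun j => u (x + j) - u x) (by simp) B hB _ (Psi2_eq β u x) hP l t ht ht1))
  linarith

lemma final_gen (β : ℝ) (hβ : 0 < β) (p e C : ℝ) (hp : 1 < p) (hC : 0 < C) (he : 1 / p ≤ e)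
    (h : ∀ u : ℤ → ℝ, BddFun u → ∀ x : ℤ,
    Psi2 (kpow β) u x ≤ 1 → -Lop (kpow β) u x ≤ C * (Psi2 (kpow β) u x) ^ e) :
    ∃ c₁ c₂ ν : ℝ, 0 < c₁ ∧ 0 < c₂ ∧ 0 < ν ∧ ∃ F : ℝ → ℝ,
        IsCDFunction F ∧ CDUps (kpow β) F ∧
        Tendsto (fun x => F x / (c₁ * x ^ p)) (nhdsWithin 0 (Ioi 0)) (nhds 1) ∧
        Tendsto (fun x => F x / (c₂ * Real.exp (ν * x))) atTop (nhds 1) := by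
  obtain ⟨C2, hC2, h2⟩ := large_final β hβ
  have hp0 : 0 < 1 / p := by positivity
  refine assemble _ p (C + C2) hp (by positivity) (fun u hu x => ⟨Psi2_nonneg β u x, ?_, ?_⟩)
  · intro hP
    have hn := Psi2_nonneg β u x
    have h3 := h u hu x hP
    have h4 : (Psi2 (kpow β) u x) ^ e ≤ (Psi2 (kpow β) u x) ^ (1 / p) :=
      Real.rpow_le_rpow_of_exponent_ge_of_imp hn hP he (fun _ h => absurd h (hp0.trans_le he).ne')
    have h5 : 0 ≤ (Psi2 (kpow β) u x) ^ (1 / p) := by positivity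
    nlinarith
  · intro hP
    have h3 := h2 u hu x hP
    have := Real.log_nonneg hP
    nlinarith


/-- Theorem (CD-function for the power-type kernel, `β ∈ (0,2)`): with `β* = (1+√5)/2`,
if `β ≤ β*` then `L_β` satisfies `CD_Υ(0,F)` with a CD-function behaving like
`c₁ x^{(1+2β)/β}` at `0` and `c₂ e^{νx}` at `∞`; if `β > β*` then for every
`ε ∈ (0,β−1)` it satisfies `CD_Υ(0,F)` with a CD-function behaving like
`c₃ x^{(β−ε)/(β−ε−1)}` at `0` and `c₄ e^{νx}` at `∞`. -/
theorem powertype_CD_asymptotics (β : ℝ) (hβ0 : 0 < β) (hβ2 : β < 2) :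
    (β ≤ (1 + Real.sqrt 5) / 2 →
      ∃ c₁ c₂ ν : ℝ, 0 < c₁ ∧ 0 < c₂ ∧ 0 < ν ∧ ∃ F : ℝ → ℝ,
        IsCDFunction F ∧ CDUps (kpow β) F ∧
        Tendsto (fun x => F x / (c₁ * x ^ ((1 + 2 * β) / β)))
          (nhdsWithin 0 (Ioi 0)) (nhds 1) ∧
        Tendsto (fun x => F x / (c₂ * Real.exp (ν * x))) atTop (nhds 1)) ∧
    ((1 + Real.sqrt 5) / 2 < β →
      ∀ ε : ℝ, 0 < ε → ε < β - 1 →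
        ∃ c₃ c₄ ν : ℝ, 0 < c₃ ∧ 0 < c₄ ∧ 0 < ν ∧ ∃ F : ℝ → ℝ,
          IsCDFunction F ∧ CDUps (kpow β) F ∧
          Tendsto (fun x => F x / (c₃ * x ^ ((β - ε) / (β - ε - 1))))
            (nhdsWithin 0 (Ioi 0)) (nhds 1) ∧
          Tendsto (fun x => F x / (c₄ * Real.exp (ν * x))) atTop (nhds 1)) := by
  constructor
  · intro _
    obtain ⟨C, hC, h⟩ := small_final_one β hβ0
    refine final_gen β hβ0 ((1 + 2 * β) / β) _ C ?_ hC ?_ h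
    · rw [one_lt_div hβ0]; linarith
    · rw [one_div_div]
  · intro hb ε hε hε1
    have hβ1 : 1 < β := by linarith
    obtain ⟨C, hC, h⟩ := small_final_two β hβ1 hβ2
    refine final_gen β hβ0 ((β - ε) / (β - ε - 1)) _ C ?_ hC ?_ h
    · rw [one_lt_div (by linarith)]; linarith
    · rw [one_div_div, div_le_div_iff₀ (by linarith) hβ0]
      nlinarith
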